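/- arXiv:math/0501461 — 3 statements merged into one kernel-verified Lean document; each statement's English description precedes it below -/
import Mathlib

section
/- Let n ≥ 2, let μ ∈ (0,1], let d be a real number with d ≠ 2, and let F : Sym_n(ℝ) → ℝ be continuously differentiable and uniformly elliptic, in the sense that for every symmetric matrix M and every symmetric positive semidefinite matrix P one has μ·tr(P) ≤ DF(M)(P) ≤ μ⁻¹·tr(P). Suppose u : ℝⁿ → ℝ is twice continuously differentiable on ℝⁿ \ {0}, positively homogeneous of degree d (i.e. u(t·x) = t^d·u(x) for all t > 0 and x ≠ 0), and satisfies F(D²u(x)) = 0 for all x ≠ 0. Then u is a solution of the constant-coefficient linear equation given by the linearization of F at the zero matrix: ∑_{i,j=1}^{n} F_{ij}(0)·D_{ij}u(x) = 0 for all x ≠ 0, where F_{ij}(0) denotes the partial derivative of F with respect to the (i,j) matrix entry evaluated at the zero matrix, i.e. DF(0)(D²u(x)) = 0. -/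
attribute [local instance] Matrix.normedAddCommGroup Matrix.normedSpace

/-- The Hessian matrix of second partial derivatives of `u : ℝⁿ → ℝ`. -/
noncomputable def hessian {n : ℕ} (u : EuclideanSpace ℝ (Fin n) → ℝ)
    (x : EuclideanSpace ℝ (Fin n)) : Matrix (Fin n) (Fin n) ℝ :=
  Matrix.of fun i j =>
    fderiv ℝ (fun y => fderiv ℝ u y (EuclideanSpace.single j (1 : ℝ))) x
      (EuclideanSpace.single i (1 : ℝ))

/-- The directional derivatives of a positively homogeneous function of degree `d` are positively
homogeneous of degree `d - 1`. -/
theorem fderiv_apply_smul_of_homogeneous {E : Type*} [NormedAddCommGroup E] [NormedSpace ℝ E]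
    {g : E → ℝ} {d : ℝ}
    (hg : ∀ t : ℝ, 0 < t → ∀ x : E, x ≠ 0 → g (t • x) = t ^ d * g x) (v : E) :
    ∀ t : ℝ, 0 < t → ∀ x : E, x ≠ 0 →
      fderiv ℝ g (t • x) v = t ^ (d - 1) * fderiv ℝ g x v := by
  intro t ht x hx
  have heq : (fun y => g (t • y)) =ᶠ[nhds x] t ^ d • g := by
    filter_upwards [isOpen_ne.mem_nhds hx] with y hy
    simpa using hg t ht y hy
  have h := heq.fderiv_eq (𝕜 := ℝ)
  rw [fderiv_comp_smul, fderiv_const_smul_field] at h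
  have h' : t * fderiv ℝ g (t • x) v = t ^ d * fderiv ℝ g x v := by
    simpa using congrArg (fun L : E →L[ℝ] ℝ => L v) h
  rw [Real.rpow_sub_one ht.ne', div_mul_eq_mul_div, eq_div_iff ht.ne', mul_comm, h']

/-- The Hessian of a positively homogeneous function of degree `d` is positively homogeneous of
degree `d - 2`. -/
theorem hessian_smul_of_homogeneous {n : ℕ} {u : EuclideanSpace ℝ (Fin n) → ℝ} {d : ℝ}
    (hu : ∀ t : ℝ, 0 < t → ∀ x : EuclideanSpace ℝ (Fin n), x ≠ 0 → u (t • x) = t ^ d * u x)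
    {t : ℝ} (ht : 0 < t) {x : EuclideanSpace ℝ (Fin n)} (hx : x ≠ 0) :
    hessian u (t • x) = t ^ (d - 2) • hessian u x := by
  ext i j
  have h := fderiv_apply_smul_of_homogeneous
    (g := fun y => fderiv ℝ u y (EuclideanSpace.single j (1 : ℝ))) (d := d - 1)
    (fderiv_apply_smul_of_homogeneous hu (EuclideanSpace.single j (1 : ℝ)))
    (EuclideanSpace.single i (1 : ℝ)) t ht x hx
  rw [show d - 1 - 1 = d - 2 by ring] at h
  simpa [hessian] using h

/-- If `F` vanishes on the open ray spanned by `v`, its derivative at `0` kills `v`. -/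
theorem fderiv_zero_apply_eq_zero_of_ray {E : Type*} [NormedAddCommGroup E] [NormedSpace ℝ E]
    {F : E → ℝ} (hF : DifferentiableAt ℝ F 0) {v : E} (hv : ∀ s : ℝ, 0 < s → F (s • v) = 0) :
    fderiv ℝ F 0 v = 0 := by
  have hline : HasDerivAt (fun s : ℝ => F (s • v)) (fderiv ℝ F 0 v) 0 := by
    have hs : HasDerivAt (fun s : ℝ => s • v) v 0 := by
      simpa using (hasDerivAt_id (0 : ℝ)).smul_const v
    refine HasFDerivAt.comp_hasDerivAt (f := fun s : ℝ => s • v) (0 : ℝ) ?_ hs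
    simpa using hF.hasFDerivAt
  have hzero : (fun s : ℝ => F (s • v)) =ᶠ[nhdsWithin 0 (Set.Ioi 0)] fun _ => 0 := by
    filter_upwards [self_mem_nhdsWithin] with s hs using hv s hs
  have hF0 : F ((0 : ℝ) • v) = 0 :=
    tendsto_nhds_unique (hline.continuousAt.tendsto.mono_left nhdsWithin_le_nhds)
      (tendsto_const_nhds.congr' hzero.symm)
  exact (uniqueDiffWithinAt_Ioi (0 : ℝ)).eq_deriv _ hline.hasDerivWithinAt
    ((hasDerivWithinAt_const _ _ (0 : ℝ)).congr_of_eventuallyEq hzero hF0)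

theorem stmt0 {n : ℕ} (hn : 2 ≤ n) (μ : ℝ) (hμ : 0 < μ) (hμ1 : μ ≤ 1)
    (d : ℝ) (hd : d ≠ 2)
    (F : Matrix (Fin n) (Fin n) ℝ → ℝ)
    (hF : ContDiff ℝ 1 F)
    (hFell : ∀ M : Matrix (Fin n) (Fin n) ℝ, M.IsSymm →
      ∀ P : Matrix (Fin n) (Fin n) ℝ, P.IsSymm → P.PosSemidef →
        μ * P.trace ≤ fderiv ℝ F M P ∧ fderiv ℝ F M P ≤ μ⁻¹ * P.trace)
    (u : EuclideanSpace ℝ (Fin n) → ℝ)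
    (hu : ContDiffOn ℝ 2 u {(0 : EuclideanSpace ℝ (Fin n))}ᶜ)
    (hhom : ∀ t : ℝ, 0 < t → ∀ x : EuclideanSpace ℝ (Fin n), x ≠ 0 →
      u (t • x) = t ^ d * u x)
    (hsol : ∀ x : EuclideanSpace ℝ (Fin n), x ≠ 0 → F (hessian u x) = 0) :
    ∀ x : EuclideanSpace ℝ (Fin n), x ≠ 0 → fderiv ℝ F 0 (hessian u x) = 0 := by
  intro x hx
  refine fderiv_zero_apply_eq_zero_of_ray (hF.differentiable one_ne_zero).differentiableAt ?_
  intro s hs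
  have h := hsol (s ^ (d - 2)⁻¹ • x) (smul_ne_zero (Real.rpow_pos_of_pos hs _).ne' hx)
  rwa [hessian_smul_of_homogeneous hhom (Real.rpow_pos_of_pos hs _) hx,
    Real.rpow_inv_rpow hs.le (sub_ne_zero.mpr hd)] at h
end

section
/- Let n ≥ 2 and let d be a real number with −(n−2) < d < 0 or d not an integer. Suppose u : ℝⁿ → ℝ is twice continuously differentiable on ℝⁿ \ {0}, positively homogeneous of degree d, and harmonic on ℝⁿ \ {0} (i.e. Δu(x) = ∑_{i=1}^{n} D_{ii}u(x) = 0 for all x ≠ 0). Then u ≡ 0 on ℝⁿ \ {0}. -/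
open MeasureTheory Topology Filter

section Radial

variable {E : Type*} [NormedAddCommGroup E]

/-- Near the origin, a radial weight supported away from the origin vanishes. -/
theorem eventually_radial_eq_zero {β : ℝ → ℝ} (hβ : tsupport β ⊆ Set.Ioi 0) :
    ∀ᶠ x : E in 𝓝 0, β (‖x‖ ^ 2) = 0 := by
  have h0 : (0 : ℝ) ∉ tsupport β := fun h => lt_irrefl (0 : ℝ) (hβ h)
  have hc : Tendsto (fun x : E => ‖x‖ ^ 2) (𝓝 0) (𝓝 0) := by
    have : Continuous fun x : E => ‖x‖ ^ 2 := by fun_prop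
    simpa using this.tendsto 0
  exact hc.eventually (notMem_tsupport_iff_eventuallyEq.mp h0)

theorem continuous_radial_mul {β : ℝ → ℝ} (hβ : tsupport β ⊆ Set.Ioi 0) (hc : Continuous β)
    {h : E → ℝ} (hh : ContinuousOn h {0}ᶜ) : Continuous fun x => β (‖x‖ ^ 2) * h x := by
  rw [continuous_iff_continuousAt]
  intro x
  rcases eq_or_ne x 0 with rfl | hx
  · refine (continuousAt_const (y := (0 : ℝ))).congr ?_
    filter_upwards [eventually_radial_eq_zero (E := E) hβ] with y hy
    simp [hy]
  · have := hh.continuousAt (isOpen_compl_singleton.mem_nhds hx)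
    fun_prop

variable [InnerProductSpace ℝ E]

theorem contDiff_radial_mul {β : ℝ → ℝ} (hβ : tsupport β ⊆ Set.Ioi 0) (hc : ContDiff ℝ 1 β)
    {h : E → ℝ} (hh : ContDiffOn ℝ 1 h {0}ᶜ) :
    ContDiff ℝ 1 fun x => β (‖x‖ ^ 2) * h x := by
  rw [contDiff_iff_contDiffAt]
  intro x
  rcases eq_or_ne x 0 with rfl | hx
  · refine (contDiffAt_const (c := (0 : ℝ))).congr_of_eventuallyEq ?_
    filter_upwards [eventually_radial_eq_zero (E := E) hβ] with y hy
    simp [hy]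
  · have h1 := hh.contDiffAt (isOpen_compl_singleton.mem_nhds hx)
    have h2 : ContDiff ℝ 1 fun x : E => β (‖x‖ ^ 2) := hc.comp (contDiff_norm_sq ℝ)
    exact h2.contDiffAt.mul h1

theorem fderiv_radial_mul {β : ℝ → ℝ} (hβ : tsupport β ⊆ Set.Ioi 0) (hc : ContDiff ℝ 1 β)
    {h : E → ℝ} (hh : ContDiffOn ℝ 1 h {0}ᶜ) (x v : E) :
    fderiv ℝ (fun x => β (‖x‖ ^ 2) * h x) x v =
      2 * deriv β (‖x‖ ^ 2) * inner ℝ x v * h x + β (‖x‖ ^ 2) * fderiv ℝ h x v := by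
  rcases eq_or_ne x 0 with rfl | hx
  · have h0 : (fun x => β (‖x‖ ^ 2) * h x) =ᶠ[𝓝 0] fun _ => 0 := by
      filter_upwards [eventually_radial_eq_zero (E := E) hβ] with y hy
      simp [hy]
    rw [h0.fderiv_eq]
    have := (eventually_radial_eq_zero (E := E) hβ).self_of_nhds
    simp only [this]
    simp
  · have h1 := ((hh.contDiffAt (isOpen_compl_singleton.mem_nhds hx)).differentiableAt
      one_ne_zero).hasFDerivAt
    have h2 := ((hc.differentiable one_ne_zero) (‖x‖ ^ 2)).hasDerivAt.comp_hasFDerivAt x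
      (hasStrictFDerivAt_norm_sq x).hasFDerivAt
    have h3 := (h2.mul h1).fderiv
    simp only [Function.comp_def] at h3
    erw [h3]
    simp
    ring

variable [FiniteDimensional ℝ E]

theorem hasCompactSupport_radial_mul {β : ℝ → ℝ} (hs : HasCompactSupport β) (h : E → ℝ) :
    HasCompactSupport fun x => β (‖x‖ ^ 2) * h x := by
  obtain ⟨R, hR⟩ := hs.isCompact.isBounded.subset_closedBall 0
  refine HasCompactSupport.intro (isCompact_closedBall (0 : E) (R + 1)) fun x hx => ?_
  have h1 : R + 1 < ‖x‖ := by simpa using hx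
  have h2 : ‖x‖ ^ 2 ∉ tsupport β := fun hm => by
    have h3 := hR hm
    rw [mem_closedBall_zero_iff, Real.norm_of_nonneg (by positivity)] at h3
    nlinarith [sq_nonneg (‖x‖ - 1), norm_nonneg x]
  simp [image_eq_zero_of_notMem_tsupport h2]

variable [MeasurableSpace E] [BorelSpace E]

theorem integrable_radial_mul {β : ℝ → ℝ} (hβ : tsupport β ⊆ Set.Ioi 0) (hc : Continuous β)
    (hs : HasCompactSupport β) {h : E → ℝ} (hh : ContinuousOn h {0}ᶜ) :
    Integrable fun x => β (‖x‖ ^ 2) * h x :=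
  (continuous_radial_mul hβ hc hh).integrable_of_hasCompactSupport
    (hasCompactSupport_radial_mul hs h)

/-- The integral of a directional derivative of a compactly supported function vanishes. -/
theorem integral_fderiv_apply_eq_zero {g : E → ℝ} (hg : ContDiff ℝ 1 g)
    (hs : HasCompactSupport g) (v : E) : ∫ x, fderiv ℝ g x v = 0 := by
  have h1 : Integrable fun x => fderiv ℝ g x v :=
    ((hg.continuous_fderiv one_ne_zero).clm_apply continuous_const).integrable_of_hasCompactSupport
      (hs.fderiv_apply (𝕜 := ℝ) v)
  have := integral_mul_fderiv_eq_neg_fderiv_mul_of_integrable (μ := (volume : Measure E))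
    (f := g) (g := fun _ => (1 : ℝ)) (v := v) (by simpa using h1) (by simp)
    (by simpa using hg.continuous.integrable_of_hasCompactSupport hs)
    (fun x _ => hg.differentiable one_ne_zero x) (fun x _ => by fun_prop)
  simpa using this

end Radial

section Euclidean

variable {n : ℕ}

local notation "𝔼" => EuclideanSpace ℝ (Fin n)

theorem sum_integral_fderiv_radial_mul {β : ℝ → ℝ} (hβ : tsupport β ⊆ Set.Ioi 0)
    (hc : ContDiff ℝ 1 β) (hs : HasCompactSupport β) {h : Fin n → 𝔼 → ℝ}
    (hh : ∀ i, ContDiffOn ℝ 1 (h i) {0}ᶜ) :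
    ∫ x : 𝔼, ∑ i, (2 * deriv β (‖x‖ ^ 2) * x i * h i x +
      β (‖x‖ ^ 2) * fderiv ℝ (h i) x (EuclideanSpace.single i 1)) = 0 := by
  have key : ∀ i, (fun x : 𝔼 => 2 * deriv β (‖x‖ ^ 2) * x i * h i x +
      β (‖x‖ ^ 2) * fderiv ℝ (h i) x (EuclideanSpace.single i 1)) =
      fun x => fderiv ℝ (fun x => β (‖x‖ ^ 2) * h i x) x (EuclideanSpace.single i 1) := by
    intro i
    ext x
    rw [fderiv_radial_mul hβ hc (hh i)]
    simp [EuclideanSpace.inner_single_right]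
  rw [integral_finsetSum]
  · refine Finset.sum_eq_zero fun i _ => ?_
    rw [key i]
    exact integral_fderiv_apply_eq_zero (contDiff_radial_mul hβ hc (hh i))
      (hasCompactSupport_radial_mul hs _) _
  · intro i _
    rw [key i]
    exact (((contDiff_radial_mul hβ hc (hh i)).continuous_fderiv
      one_ne_zero).clm_apply continuous_const).integrable_of_hasCompactSupport
      ((hasCompactSupport_radial_mul hs _).fderiv_apply (𝕜 := ℝ) _)

theorem sum_coord_mul_fderiv (u : 𝔼 → ℝ) (x : 𝔼) :
    ∑ i, x i * fderiv ℝ u x (EuclideanSpace.single i 1) = fderiv ℝ u x x := by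
  conv_rhs => arg 2; rw [← (EuclideanSpace.basisFun (Fin n) ℝ).sum_repr x]
  simp

theorem contDiffOn_fderiv_apply {u : 𝔼 → ℝ} (hu : ContDiffOn ℝ 2 u {0}ᶜ) (v : 𝔼) :
    ContDiffOn ℝ 1 (fun x => fderiv ℝ u x v) {0}ᶜ :=
  (hu.fderiv_of_isOpen isOpen_compl_singleton (by norm_num)).clm_apply contDiffOn_const

/-- Integrating the divergence of the radially weighted field `x ↦ u(x) p(x) x`, where `u` and `p`
satisfy Euler's relation with degrees `d` and `k`. -/
theorem integral_radial_euler {β : ℝ → ℝ} (hβ : tsupport β ⊆ Set.Ioi 0)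
    (hc : ContDiff ℝ 1 β) (hs : HasCompactSupport β) {u p : 𝔼 → ℝ} {d k : ℝ}
    (hu : ContDiffOn ℝ 2 u {0}ᶜ) (hp : ContDiffOn ℝ 2 p {0}ᶜ)
    (hud : ∀ x ≠ 0, fderiv ℝ u x x = d * u x) (hpk : ∀ x ≠ 0, fderiv ℝ p x x = k * p x) :
    ∫ x : 𝔼, (2 * (‖x‖ ^ 2 * deriv β (‖x‖ ^ 2)) + (n + d + k) * β (‖x‖ ^ 2)) * (u x * p x)
      = 0 := by
  have h1 : ∀ i : Fin n, ContDiffOn ℝ 1 (fun x : 𝔼 => x i * (u x * p x)) {0}ᶜ := fun i =>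
    ContDiffOn.mul (by fun_prop) ((hu.mul hp).of_le (by norm_num))
  rw [← sum_integral_fderiv_radial_mul hβ hc hs h1]
  refine integral_congr_ae ?_
  filter_upwards [] with x
  rcases eq_or_ne x 0 with rfl | hx
  · have := (eventually_radial_eq_zero (E := 𝔼) hβ).self_of_nhds
    simp only [this]
    simp
  have hN := isOpen_compl_singleton.mem_nhds hx
  have hu1 := ((hu.contDiffAt hN).differentiableAt two_ne_zero).hasFDerivAt
  have hp1 := ((hp.contDiffAt hN).differentiableAt two_ne_zero).hasFDerivAt
  have h2 : ∀ i, fderiv ℝ (fun x : 𝔼 => x i * (u x * p x)) x (EuclideanSpace.single i 1) =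
      u x * p x + p x * (x i * fderiv ℝ u x (EuclideanSpace.single i 1))
        + u x * (x i * fderiv ℝ p x (EuclideanSpace.single i 1)) := by
    intro i
    have hi : HasFDerivAt (fun x : 𝔼 => x i) (EuclideanSpace.proj i : 𝔼 →L[ℝ] ℝ) x :=
      (EuclideanSpace.proj i : 𝔼 →L[ℝ] ℝ).hasFDerivAt
    have := (hi.mul (hu1.mul hp1)).fderiv
    erw [this]
    simp
    ring
  simp only [h2]
  have h3 : ∑ i, x i * x i = ‖x‖ ^ 2 := by
    rw [EuclideanSpace.real_norm_sq_eq]; simp [sq]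
  have h4 : ∀ i, 2 * deriv β (‖x‖ ^ 2) * x i * (x i * (u x * p x)) +
      β (‖x‖ ^ 2) * (u x * p x + p x * (x i * fderiv ℝ u x (EuclideanSpace.single i 1))
        + u x * (x i * fderiv ℝ p x (EuclideanSpace.single i 1))) =
      2 * deriv β (‖x‖ ^ 2) * (u x * p x) * (x i * x i) + β (‖x‖ ^ 2) * (u x * p x) +
      β (‖x‖ ^ 2) * p x * (x i * fderiv ℝ u x (EuclideanSpace.single i 1)) +
      β (‖x‖ ^ 2) * u x * (x i * fderiv ℝ p x (EuclideanSpace.single i 1)) := by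
    intro i; ring
  simp only [h4, Finset.sum_add_distrib, ← Finset.mul_sum, h3, sum_coord_mul_fderiv, hud x hx,
    hpk x hx]
  simp
  ring

/-- Green's identity with a radial weight: integrating the divergence of the radially weighted
field `p ∇u - u ∇p`. -/
theorem integral_radial_green {β : ℝ → ℝ} (hβ : tsupport β ⊆ Set.Ioi 0)
    (hc : ContDiff ℝ 1 β) (hs : HasCompactSupport β) {u p : 𝔼 → ℝ} {d k : ℝ}
    (hu : ContDiffOn ℝ 2 u {0}ᶜ) (hp : ContDiffOn ℝ 2 p {0}ᶜ)
    (hud : ∀ x ≠ 0, fderiv ℝ u x x = d * u x) (hpk : ∀ x ≠ 0, fderiv ℝ p x x = k * p x)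
    (hharm : ∀ x ≠ 0, (hessian u x).trace = 0) :
    ∫ x : 𝔼, (2 * (d - k) * deriv β (‖x‖ ^ 2) * (u x * p x) -
      β (‖x‖ ^ 2) * (u x * (hessian p x).trace)) = 0 := by
  have h1 : ∀ i : Fin n, ContDiffOn ℝ 1 (fun x : 𝔼 =>
      p x * fderiv ℝ u x (EuclideanSpace.single i 1) -
      u x * fderiv ℝ p x (EuclideanSpace.single i 1)) {0}ᶜ := fun i =>
    ((hp.of_le (by norm_num)).mul (contDiffOn_fderiv_apply hu _)).sub
      ((hu.of_le (by norm_num)).mul (contDiffOn_fderiv_apply hp _))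
  rw [← sum_integral_fderiv_radial_mul hβ hc hs h1]
  refine integral_congr_ae ?_
  filter_upwards [] with x
  rcases eq_or_ne x 0 with rfl | hx
  · have h0 := (eventually_radial_eq_zero (E := 𝔼) hβ).self_of_nhds
    have h0' : deriv β (‖(0 : 𝔼)‖ ^ 2) = 0 :=
      (eventually_radial_eq_zero (E := 𝔼)
        ((tsupport_deriv_subset (𝕜 := ℝ) (f := β)).trans hβ)).self_of_nhds
    simp only [h0, h0']
    simp
  have hN := isOpen_compl_singleton.mem_nhds hx
  have hu1 := ((hu.contDiffAt hN).differentiableAt two_ne_zero).hasFDerivAt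
  have hp1 := ((hp.contDiffAt hN).differentiableAt two_ne_zero).hasFDerivAt
  have h2 : ∀ i, fderiv ℝ (fun x : 𝔼 =>
      p x * fderiv ℝ u x (EuclideanSpace.single i 1) -
      u x * fderiv ℝ p x (EuclideanSpace.single i 1)) x (EuclideanSpace.single i 1) =
      p x * hessian u x i i - u x * hessian p x i i := by
    intro i
    have hu2 := (((contDiffOn_fderiv_apply hu (EuclideanSpace.single i 1)).contDiffAt
      hN).differentiableAt one_ne_zero).hasFDerivAt
    have hp2 := (((contDiffOn_fderiv_apply hp (EuclideanSpace.single i 1)).contDiffAt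
      hN).differentiableAt one_ne_zero).hasFDerivAt
    have := ((hp1.mul hu2).sub (hu1.mul hp2)).fderiv
    erw [this]
    simp [hessian]
    ring
  simp only [h2]
  have h4 : ∀ i, 2 * deriv β (‖x‖ ^ 2) * x i * (p x * fderiv ℝ u x (EuclideanSpace.single i 1) -
      u x * fderiv ℝ p x (EuclideanSpace.single i 1)) +
      β (‖x‖ ^ 2) * (p x * hessian u x i i - u x * hessian p x i i) =
      2 * deriv β (‖x‖ ^ 2) * p x * (x i * fderiv ℝ u x (EuclideanSpace.single i 1)) -
      2 * deriv β (‖x‖ ^ 2) * u x * (x i * fderiv ℝ p x (EuclideanSpace.single i 1)) +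
      (β (‖x‖ ^ 2) * p x * hessian u x i i - β (‖x‖ ^ 2) * u x * hessian p x i i) := by
    intro i; ring
  have h5 := hharm x hx
  simp only [Matrix.trace, Matrix.diag] at h5 ⊢
  simp only [h4, Finset.sum_add_distrib, Finset.sum_sub_distrib, ← Finset.mul_sum,
    sum_coord_mul_fderiv, hud x hx, hpk x hx, h5]
  ring

theorem tsupport_id_mul_subset (β : ℝ → ℝ) : tsupport (fun s => s * β s) ⊆ tsupport β :=
  closure_mono (Function.support_mul_subset_right _ _)

/-- The reduction formula for radially weighted moments of a homogeneous harmonic function. -/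
theorem integral_radial_reduction {β : ℝ → ℝ} (hβ : tsupport β ⊆ Set.Ioi 0)
    (hc : ContDiff ℝ 1 β) (hs : HasCompactSupport β) {u p : 𝔼 → ℝ} {d k : ℝ}
    (hu : ContDiffOn ℝ 2 u {0}ᶜ) (hp : ContDiffOn ℝ 2 p {0}ᶜ)
    (hud : ∀ x ≠ 0, fderiv ℝ u x x = d * u x) (hpk : ∀ x ≠ 0, fderiv ℝ p x x = k * p x)
    (hharm : ∀ x ≠ 0, (hessian u x).trace = 0) :
    (d - k) * (d + k + n - 2) * ∫ x : 𝔼, β (‖x‖ ^ 2) * (u x * p x) =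
      -∫ x : 𝔼, (‖x‖ ^ 2 * β (‖x‖ ^ 2)) * (u x * (hessian p x).trace) := by
  have hβ' := (tsupport_deriv_subset (𝕜 := ℝ) (f := β)).trans hβ
  have hc' : Continuous (deriv β) := hc.continuous_deriv le_rfl
  have hs' : HasCompactSupport (deriv β) := hs.deriv
  have hsβ := (tsupport_id_mul_subset β).trans hβ
  have hup : ContinuousOn (fun x => u x * p x) {0}ᶜ := hu.continuousOn.mul hp.continuousOn
  have hq : ContinuousOn (fun x => u x * (hessian p x).trace) {0}ᶜ := by
    refine hu.continuousOn.mul ?_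
    simp only [Matrix.trace, Matrix.diag, hessian, Matrix.of_apply]
    refine continuousOn_finsetSum _ fun i _ => ?_
    exact ((contDiffOn_fderiv_apply hp _).continuousOn_fderiv_of_isOpen
      isOpen_compl_singleton le_rfl).clm_apply continuousOn_const
  have hA := integral_radial_euler hβ hc hs hu hp hud hpk
  have hB := integral_radial_green (β := fun s => s * β s) hsβ (contDiff_id.mul hc) hs.mul_left
    hu hp hud hpk hharm
  have hd : ∀ s, deriv (fun s => s * β s) s = β s + s * deriv β s := fun s => by
    have := ((hasDerivAt_id s).mul ((hc.differentiable one_ne_zero) s).hasDerivAt).deriv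
    erw [this]; simp
  have i1 := integrable_radial_mul (E := 𝔼) hβ hc.continuous hs hup
  have i2 := integrable_radial_mul (E := 𝔼) ((tsupport_id_mul_subset (deriv β)).trans hβ')
    (continuous_id.mul hc') hs'.mul_left hup
  have i3 := integrable_radial_mul (E := 𝔼) hsβ (continuous_id.mul hc.continuous) hs.mul_left hq
  have i12 : Integrable fun x : 𝔼 => 2 * (d - k) * (β (‖x‖ ^ 2) * (u x * p x)) +
      2 * (d - k) * ((‖x‖ ^ 2 * deriv β (‖x‖ ^ 2)) * (u x * p x)) :=
    (i1.const_mul _).add (i2.const_mul _)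
  simp only [hd] at hB
  have eA : (fun x : 𝔼 => (2 * (‖x‖ ^ 2 * deriv β (‖x‖ ^ 2)) + (n + d + k) * β (‖x‖ ^ 2)) *
      (u x * p x)) = fun x => 2 * ((‖x‖ ^ 2 * deriv β (‖x‖ ^ 2)) * (u x * p x)) +
      (n + d + k) * (β (‖x‖ ^ 2) * (u x * p x)) := by ext x; ring
  have eB : (fun x : 𝔼 => 2 * (d - k) * (β (‖x‖ ^ 2) + ‖x‖ ^ 2 * deriv β (‖x‖ ^ 2)) *
      (u x * p x) - ‖x‖ ^ 2 * β (‖x‖ ^ 2) * (u x * (hessian p x).trace)) =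
      fun x => (2 * (d - k) * (β (‖x‖ ^ 2) * (u x * p x)) +
      2 * (d - k) * ((‖x‖ ^ 2 * deriv β (‖x‖ ^ 2)) * (u x * p x))) -
      ‖x‖ ^ 2 * β (‖x‖ ^ 2) * (u x * (hessian p x).trace) := by ext x; ring
  rw [eA, integral_add (i2.const_mul _) (i1.const_mul _), integral_const_mul,
    integral_const_mul] at hA
  rw [eB, integral_sub i12 i3,
    integral_add (i1.const_mul _) (i2.const_mul _), integral_const_mul,
    integral_const_mul] at hB
  linear_combination (d - k) * hA - hB

theorem fderiv_inner_pow (a : 𝔼) (k : ℕ) (x v : 𝔼) :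
    fderiv ℝ (fun x => inner ℝ a x ^ k) x v = k * inner ℝ a v * inner ℝ a x ^ (k - 1) := by
  have h : HasFDerivAt (fun x : 𝔼 => inner ℝ a x) (innerSL ℝ a) x := (innerSL ℝ a).hasFDerivAt
  rw [(h.pow k).fderiv]
  simp
  ring

theorem fderiv_inner_pow_self (a : 𝔼) (k : ℕ) (x : 𝔼) :
    fderiv ℝ (fun x => inner ℝ a x ^ k) x x = k * inner ℝ a x ^ k := by
  rw [fderiv_inner_pow]
  cases k with
  | zero => simp
  | succ k => simp [pow_succ]; ring

theorem trace_hessian_inner_pow (a : 𝔼) (k : ℕ) (x : 𝔼) :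
    (hessian (fun x => inner ℝ a x ^ k) x).trace =
      k * ((k - 1 : ℕ) : ℝ) * ‖a‖ ^ 2 * inner ℝ a x ^ (k - 2) := by
  simp only [Matrix.trace, Matrix.diag, hessian, Matrix.of_apply, fderiv_inner_pow]
  have h1 : ∀ i : Fin n, fderiv ℝ (fun y : 𝔼 => (k : ℝ) * inner ℝ a (EuclideanSpace.single i 1) *
      inner ℝ a y ^ (k - 1)) x (EuclideanSpace.single i 1) =
      k * ((k - 1 : ℕ) : ℝ) * inner ℝ a x ^ (k - 2) * a i ^ 2 := by
    intro i
    have hdiff : DifferentiableAt ℝ (fun y : 𝔼 => inner ℝ a y ^ (k - 1)) x :=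
      (innerSL ℝ a).differentiableAt.pow _
    rw [fderiv_const_mul hdiff]
    simp only [smul_apply, fderiv_inner_pow, smul_eq_mul]
    simp [EuclideanSpace.inner_single_right, Nat.sub_sub]
    ring
  simp only [h1, ← Finset.mul_sum, EuclideanSpace.real_norm_sq_eq]
  ring

theorem integral_radial_inner_pow_eq_zero {u : 𝔼 → ℝ} {d : ℝ}
    (hd : ∀ k : ℕ, (d - k) * (d + k + n - 2) ≠ 0) (hu : ContDiffOn ℝ 2 u {0}ᶜ)
    (hud : ∀ x ≠ 0, fderiv ℝ u x x = d * u x) (hharm : ∀ x ≠ 0, (hessian u x).trace = 0)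
    (a : 𝔼) (k : ℕ) : ∀ {β : ℝ → ℝ}, tsupport β ⊆ Set.Ioi 0 → ContDiff ℝ 1 β →
      HasCompactSupport β → ∫ x : 𝔼, β (‖x‖ ^ 2) * (u x * inner ℝ a x ^ k) = 0 := by
  induction k using Nat.strong_induction_on with
  | _ k ih =>
    intro β hβ hc hs
    have h := integral_radial_reduction hβ hc hs (p := fun x => inner ℝ a x ^ k) hu
      ((innerSL ℝ a).contDiff.pow k).contDiffOn
      hud (fun x _ => fderiv_inner_pow_self a k x) hharm
    simp only [trace_hessian_inner_pow] at h
    refine (mul_eq_zero.mp (h.trans ?_)).resolve_left (hd k)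
    rw [neg_eq_zero]
    rcases lt_or_ge k 2 with hk | hk
    · interval_cases k <;> simp
    · have h1 := ih (k - 2) (by omega) (β := fun s => s * β s)
        ((tsupport_id_mul_subset β).trans hβ) (contDiff_id.mul hc) hs.mul_left
      rw [← mul_zero (k * ((k - 1 : ℕ) : ℝ) * ‖a‖ ^ 2), ← h1, ← integral_const_mul]
      congr 1
      ext x
      ring

theorem fderiv_self_of_homogeneous {u : 𝔼 → ℝ} {d : ℝ}
    (hhom : ∀ t : ℝ, 0 < t → ∀ x : 𝔼, x ≠ 0 → u (t • x) = t ^ d * u x) {x : 𝔼} (hx : x ≠ 0)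
    (hu : DifferentiableAt ℝ u x) : fderiv ℝ u x x = d * u x := by
  have h1 : HasDerivAt (fun t : ℝ => t • x) x 1 := by
    simpa using (hasDerivAt_id (1 : ℝ)).smul_const x
  have h2 : HasDerivAt (fun t : ℝ => u (t • x)) (fderiv ℝ u x x) 1 :=
    HasFDerivAt.comp_hasDerivAt (f := fun t : ℝ => t • x) 1
      (by simpa using hu.hasFDerivAt) h1
  have h3 : HasDerivAt (fun t : ℝ => t ^ d * u x) (d * u x) 1 := by
    simpa using (Real.hasDerivAt_rpow_const (x := 1) (p := d) (Or.inl one_ne_zero)).mul_const (u x)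
  refine h2.unique (h3.congr_of_eventuallyEq ?_)
  filter_upwards [lt_mem_nhds one_pos] with t ht
  exact hhom t ht x hx

end Euclidean

open scoped FourierTransform in
/-- A continuous compactly supported function all of whose moments along linear forms vanish is
zero. -/
theorem eq_zero_of_integral_mul_inner_pow_eq_zero {E : Type*} [NormedAddCommGroup E]
    [InnerProductSpace ℝ E] [FiniteDimensional ℝ E] [MeasurableSpace E] [BorelSpace E]
    {f : E → ℝ} (hf : Continuous f) (hs : HasCompactSupport f)
    (h : ∀ (a : E) (k : ℕ), ∫ x, f x * inner ℝ a x ^ k = 0) : f = 0 := by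
  let g : E → ℂ := fun x => f x
  have hg : Continuous g := by fun_prop
  have hgs : HasCompactSupport g := hs.comp_left (g := fun r : ℝ => (r : ℂ)) (by simp)
  have hF : 𝓕 g = 0 := by
    ext a
    rw [Real.fourier_eq']
    obtain ⟨R, hR⟩ := hs.isCompact.isBounded.subset_closedBall 0
    let c : E → ℂ := fun x => (-2 * Real.pi * inner ℝ x a : ℝ) * Complex.I
    have hc : Continuous c := by fun_prop
    let F : ℕ → E → ℂ := fun k x => (c x ^ k / (k.factorial : ℂ)) * g x
    have hFint : ∀ k, Integrable (F k) := fun k =>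
      Continuous.integrable_of_hasCompactSupport (by fun_prop) hgs.mul_left
    have hF0 : ∀ k, ∫ x, F k x = 0 := by
      intro k
      have : F k = fun x => ((-2 * Real.pi * Complex.I) ^ k / (k.factorial : ℂ)) *
          ((f x * inner ℝ a x ^ k : ℝ) : ℂ) := by
        ext x
        simp only [F, c, g, real_inner_comm a x]
        push_cast
        ring
      rw [this, integral_const_mul, integral_complex_ofReal, h a k]
      simp
    have hgi : Integrable fun x => ‖g x‖ :=
      (hg.integrable_of_hasCompactSupport hgs).norm
    set M := 2 * Real.pi * (R * ‖a‖) with hM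
    have hbound : ∀ k x, ‖F k x‖ ≤ (M ^ k / k.factorial) * ‖g x‖ := by
      intro k x
      by_cases hx : x ∈ tsupport f
      · have hxR : ‖x‖ ≤ R := by simpa using hR hx
        have hcx : ‖c x‖ ≤ M := by
          simp only [c, norm_mul, Complex.norm_I, mul_one, Complex.norm_real, norm_neg,
            Real.norm_ofNat, Real.norm_of_nonneg Real.pi_pos.le, hM]
          have := (norm_inner_le_norm (𝕜 := ℝ) x a).trans
            (mul_le_mul_of_nonneg_right hxR (norm_nonneg a))
          gcongr
        simp only [F, norm_mul, norm_div, norm_pow, Complex.norm_natCast]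
        gcongr
      · have : g x = 0 := by simp [g, image_eq_zero_of_notMem_tsupport hx]
        simp [F, this]
    have hsum : Summable fun k => ∫ x, ‖F k x‖ := by
      refine Summable.of_nonneg_of_le (fun k => integral_nonneg fun x => norm_nonneg _)
        (fun k => integral_mono (hFint k).norm (hgi.const_mul _) (hbound k)) ?_
      simp only [integral_const_mul]
      exact (Real.summable_pow_div_factorial M).mul_right _
    have key := (hasSum_integral_of_summable_integral_norm hFint hsum).unique
      (by simpa only [hF0] using hasSum_zero)
    refine Eq.trans ?_ key
    congr 1
    ext x
    simp only [F, tsum_mul_right, smul_eq_mul]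
    rw [Complex.exp_eq_exp_ℂ, NormedSpace.exp_eq_tsum_div]
  have hinv := hg.fourierInv_fourier_eq (hg.integrable_of_hasCompactSupport hgs)
    (by rw [hF]; exact integrable_zero _ _ _)
  ext x
  have hx := congrFun hinv x
  rw [hF, Real.fourierInv_eq'] at hx
  simpa [g] using hx.symm

theorem stmt8 {n : ℕ} (hn : 2 ≤ n) (d : ℝ)
    (hd : (-((n : ℝ) - 2) < d ∧ d < 0) ∨ ¬ ∃ k : ℤ, d = (k : ℝ))
    (u : EuclideanSpace ℝ (Fin n) → ℝ)
    (hu : ContDiffOn ℝ 2 u {(0 : EuclideanSpace ℝ (Fin n))}ᶜ)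
    (hhom : ∀ t : ℝ, 0 < t → ∀ x : EuclideanSpace ℝ (Fin n), x ≠ 0 →
      u (t • x) = t ^ d * u x)
    (hharm : ∀ x : EuclideanSpace ℝ (Fin n), x ≠ 0 → (hessian u x).trace = 0) :
    ∀ x : EuclideanSpace ℝ (Fin n), x ≠ 0 → u x = 0 := by
  have hN : ∀ x : EuclideanSpace ℝ (Fin n), x ≠ 0 → DifferentiableAt ℝ u x := fun x hx =>
    (hu.contDiffAt (isOpen_compl_singleton.mem_nhds hx)).differentiableAt two_ne_zero
  have hne : ∀ k : ℕ, (d - k) * (d + k + n - 2) ≠ 0 := by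
    intro k h0
    have hk : (0 : ℝ) ≤ k := k.cast_nonneg
    rcases mul_eq_zero.mp h0 with h1 | h1
    · rcases hd with hd | hd
      · linarith [hd.2]
      · exact hd ⟨k, by push_cast; linarith⟩
    · rcases hd with hd | hd
      · linarith [hd.1]
      · exact hd ⟨2 - n - k, by push_cast; linarith⟩
  let β : ContDiffBump (1 : ℝ) := ⟨1 / 4, 1 / 2, by norm_num, by norm_num⟩
  have hβ : tsupport β ⊆ Set.Ioi 0 := by
    rw [β.tsupport_eq]
    intro s hs
    rw [Real.closedBall_eq_Icc] at hs
    have : (1 : ℝ) - 1 / 2 ≤ s := hs.1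
    exact Set.mem_Ioi.mpr (by linarith)
  have hzero : (fun x : EuclideanSpace ℝ (Fin n) => β (‖x‖ ^ 2) * u x) = 0 := by
    refine eq_zero_of_integral_mul_inner_pow_eq_zero
      (continuous_radial_mul hβ β.continuous hu.continuousOn)
      (hasCompactSupport_radial_mul β.hasCompactSupport u) fun a k => ?_
    simp only [mul_assoc]
    exact integral_radial_inner_pow_eq_zero hne hu
      (fun x hx => fderiv_self_of_homogeneous hhom hx (hN x hx)) hharm a k hβ β.contDiff
      β.hasCompactSupport
  intro x hx
  have hx' : 0 < ‖x‖ := norm_pos_iff.mpr hx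
  have hy : ‖(‖x‖⁻¹ • x)‖ = 1 := by
    rw [norm_smul, norm_inv, norm_norm, inv_mul_cancel₀ hx'.ne']
  have h1 := congrFun hzero (‖x‖⁻¹ • x)
  simp only [hy, one_pow, Pi.zero_apply] at h1
  rw [β.one_of_mem_closedBall (Metric.mem_closedBall_self (by norm_num [β])), one_mul,
    hhom _ (inv_pos.mpr hx') x hx] at h1
  exact (mul_eq_zero.mp h1).resolve_left (Real.rpow_pos_of_pos (inv_pos.mpr hx') d).ne'
end

section
/- Let n ≥ 2 and let m be a nonnegative integer. Suppose u : ℝⁿ → ℝ is twice continuously differentiable on ℝⁿ \ {0}, positively homogeneous of degree m, and harmonic on ℝⁿ \ {0} (i.e. Δu(x) = ∑_{i=1}^{n} D_{ii}u(x) = 0 for all x ≠ 0). Then there exists a harmonic polynomial function p : ℝⁿ → ℝ, homogeneous of degree m, such that u(x) = p(x) for all x ≠ 0. -/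
open MeasureTheory Set Metric

/-- The `i`-th partial derivative of `u : ℝⁿ → ℝ`. -/
noncomputable def partialDeriv {n : ℕ} (i : Fin n) (u : EuclideanSpace ℝ (Fin n) → ℝ)
    (x : EuclideanSpace ℝ (Fin n)) : ℝ :=
  fderiv ℝ u x (EuclideanSpace.single i (1 : ℝ))

theorem trace_hessian {n : ℕ} (u : EuclideanSpace ℝ (Fin n) → ℝ)
    (x : EuclideanSpace ℝ (Fin n)) :
    (hessian u x).trace = ∑ i, partialDeriv i (partialDeriv i u) x := rfl

theorem sum_mul_fderiv_single {n : ℕ} (L : EuclideanSpace ℝ (Fin n) →L[ℝ] ℝ)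
    (x : EuclideanSpace ℝ (Fin n)) :
    ∑ i, x i * L (EuclideanSpace.single i (1 : ℝ)) = L x := by
  conv_rhs => rw [← (EuclideanSpace.basisFun (Fin n) ℝ).sum_repr x]
  simp

theorem partialDeriv_smul {n : ℕ} {u : EuclideanSpace ℝ (Fin n) → ℝ} {t c : ℝ} (ht : 0 < t)
    (hu : ∀ x ≠ 0, u (t • x) = c * u x) (i : Fin n) {x : EuclideanSpace ℝ (Fin n)}
    (hx : x ≠ 0) : partialDeriv i u (t • x) = c / t * partialDeriv i u x := by
  have h : (u <| t • ·) =ᶠ[nhds x] (c • u) := by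
    filter_upwards [isOpen_compl_singleton.mem_nhds hx] with y hy
    simpa using hu y hy
  have h1 := h.fderiv_eq (𝕜 := ℝ)
  rw [fderiv_comp_smul, fderiv_const_smul_field] at h1
  have h2 := congrArg (fun L => L (EuclideanSpace.single i (1 : ℝ))) h1
  simp only [Pi.smul_apply, smul_apply, smul_eq_mul] at h2
  rw [partialDeriv, partialDeriv]
  field_simp
  linarith

theorem trace_hessian_smul {n : ℕ} {u : EuclideanSpace ℝ (Fin n) → ℝ} {t c : ℝ} (ht : 0 < t)
    (hu : ∀ x ≠ 0, u (t • x) = c * u x) {x : EuclideanSpace ℝ (Fin n)} (hx : x ≠ 0) :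
    t ^ 2 * (hessian u (t • x)).trace = c * (hessian u x).trace := by
  simp only [trace_hessian, Finset.mul_sum]
  refine Finset.sum_congr rfl fun i _ => ?_
  rw [partialDeriv_smul ht (fun y hy => partialDeriv_smul ht hu i hy) i hx]
  field_simp

/-- Euler's identity for homogeneous functions. -/
theorem sum_mul_partialDeriv {n : ℕ} {u : EuclideanSpace ℝ (Fin n) → ℝ} {m : ℕ}
    {x : EuclideanSpace ℝ (Fin n)} (hd : DifferentiableAt ℝ u x)
    (hu : ∀ t : ℝ, 0 < t → u (t • x) = t ^ m * u x) :
    ∑ i, x i * partialDeriv i u x = m * u x := by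
  simp only [partialDeriv]
  rw [sum_mul_fderiv_single]
  have h1 : HasDerivAt (fun t : ℝ => u (t • x)) (fderiv ℝ u x x) 1 := by
    have := (hasDerivAt_id (1 : ℝ)).smul_const x
    have hd' : HasFDerivAt u (fderiv ℝ u x) ((id (1 : ℝ)) • x) := by simpa using hd.hasFDerivAt
    simpa only [one_smul, Function.comp_def, id] using hd'.comp_hasDerivAt (1 : ℝ) this
  have h2 : HasDerivAt (fun t : ℝ => t ^ m * u x) (m * u x) 1 := by
    simpa using (hasDerivAt_pow m (1 : ℝ)).mul_const (u x)
  refine h1.unique (h2.congr_of_eventuallyEq ?_)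
  filter_upwards [lt_mem_nhds one_pos] with t ht using hu t ht

theorem contDiffOn_partialDeriv {n : ℕ} {u : EuclideanSpace ℝ (Fin n) → ℝ}
    (hu : ContDiffOn ℝ 2 u {0}ᶜ) (i : Fin n) : ContDiffOn ℝ 1 (partialDeriv i u) {0}ᶜ :=
  (hu.fderiv_of_isOpen isOpen_compl_singleton (by norm_num)).clm_apply contDiffOn_const

theorem integral_fderiv_eq_zero_of_hasCompactSupport {E : Type*} [NormedAddCommGroup E]
    [NormedSpace ℝ E] [FiniteDimensional ℝ E] [MeasurableSpace E] [BorelSpace E]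
    (μ : Measure E) [μ.IsAddHaarMeasure] {f : E → ℝ} (hf : ContDiff ℝ 1 f)
    (hc : HasCompactSupport f) (v : E) : ∫ x, fderiv ℝ f x v ∂μ = 0 := by
  have h := integral_mul_fderiv_eq_neg_fderiv_mul_of_integrable (μ := μ) (f := fun _ : E => (1 : ℝ))
    (g := f) (v := v) (by simp)
    (by simpa using (((hf.continuous_fderiv one_ne_zero).clm_apply
      continuous_const).integrable_of_hasCompactSupport (hc.fderiv_apply ℝ v)))
    (by simpa using hf.continuous.integrable_of_hasCompactSupport hc)
    (by simp) (fun x _ => hf.differentiable one_ne_zero x)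
  simpa using h

/-- The integral over `ℝⁿ` of a weight `Φ` times the divergence of a vector field `V` that is
orthogonal to the gradient of `Φ` vanishes; `V` may be singular outside the support of `Φ`. -/
theorem integral_mul_divergence_eq_zero {n : ℕ} {Φ : EuclideanSpace ℝ (Fin n) → ℝ}
    {V : Fin n → EuclideanSpace ℝ (Fin n) → ℝ} {s : Set (EuclideanSpace ℝ (Fin n))}
    (hs : IsOpen s) (hΦ : ContDiff ℝ 1 Φ) (hc : HasCompactSupport Φ) (hsupp : tsupport Φ ⊆ s)
    (hV : ∀ i, ContDiffOn ℝ 1 (V i) s)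
    (hort : ∀ x ∈ s, ∑ i, partialDeriv i Φ x * V i x = 0) :
    ∫ x, Φ x * ∑ i, partialDeriv i (V i) x = 0 := by
  have hmul : ∀ i, ContDiff ℝ 1 (fun x => Φ x * V i x) := fun i => by
    refine contDiff_iff_contDiffAt.2 fun x => ?_
    by_cases hx : x ∈ tsupport Φ
    · exact hΦ.contDiffAt.mul ((hV i).contDiffAt (hs.mem_nhds (hsupp hx)))
    · have hx' : x ∉ tsupport (fun x => Φ x * V i x) := fun h => hx (tsupport_mul_subset_left h)
      exact contDiffAt_const.congr_of_eventuallyEq (notMem_tsupport_iff_eventuallyEq.1 hx')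
  have hcm : ∀ i, HasCompactSupport (fun x => Φ x * V i x) := fun i => hc.mul_right
  have key : ∀ x, Φ x * ∑ i, partialDeriv i (V i) x
      = ∑ i, fderiv ℝ (fun x => Φ x * V i x) x (EuclideanSpace.single i (1 : ℝ)) := by
    intro x
    by_cases hx : x ∈ tsupport Φ
    · have hx' := hsupp hx
      have : ∀ i, fderiv ℝ (fun x => Φ x * V i x) x (EuclideanSpace.single i (1 : ℝ))
          = Φ x * partialDeriv i (V i) x + partialDeriv i Φ x * V i x := fun i => by
        rw [fderiv_fun_mul (hΦ.differentiable one_ne_zero x)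
          (((hV i).contDiffAt (hs.mem_nhds hx')).differentiableAt one_ne_zero)]
        simp [partialDeriv, mul_comm]
      simp only [this, Finset.sum_add_distrib, hort x hx', Finset.mul_sum, add_zero]
    · rw [image_eq_zero_of_notMem_tsupport hx, zero_mul]
      refine (Finset.sum_eq_zero fun i _ => ?_).symm
      have : x ∉ tsupport (fun x => Φ x * V i x) := fun h => hx (tsupport_mul_subset_left h)
      rw [fderiv_of_notMem_tsupport ℝ this]
      simp
  simp only [key]
  rw [integral_finsetSum]
  · exact Finset.sum_eq_zero fun i _ =>
      integral_fderiv_eq_zero_of_hasCompactSupport volume (hmul i) (hcm i) _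
  · exact fun i _ => (((hmul i).continuous_fderiv one_ne_zero).clm_apply
      continuous_const).integrable_of_hasCompactSupport ((hcm i).fderiv_apply ℝ _)

/-- Integration in polar coordinates of a radial weight times a homogeneous function. -/
theorem integral_norm_mul_homogeneous {E : Type*} [NormedAddCommGroup E]
    [NormedSpace ℝ E] [FiniteDimensional ℝ E] [Nontrivial E] [MeasurableSpace E] [BorelSpace E]
    (μ : Measure E) [μ.IsAddHaarMeasure] (f : ℝ → ℝ) {F : E → ℝ} {a : ℕ}
    (hF : ∀ t : ℝ, 0 < t → ∀ x ≠ 0, F (t • x) = t ^ a * F x) :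
    ∫ x, f ‖x‖ * F x ∂μ = (∫ z : sphere (0 : E) 1, F z ∂μ.toSphere) *
      ∫ r : Ioi (0 : ℝ), r.1 ^ a * f r ∂.volumeIoiPow (Module.finrank ℝ E - 1) :=
  calc
    ∫ x, f ‖x‖ * F x ∂μ = ∫ x : ({(0)}ᶜ : Set E), f (‖x.1‖) * F x.1 ∂(μ.comap (↑)) := by
      rw [integral_subtype_comap (measurableSet_singleton _).compl fun x ↦ f (‖x‖) * F x,
        restrict_compl_singleton]
    _ = ∫ x, F x.1 * (x.2.1 ^ a * f x.2)
          ∂μ.toSphere.prod (.volumeIoiPow (Module.finrank ℝ E - 1)) := by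
      rw [← μ.measurePreserving_homeomorphUnitSphereProd.integral_comp
        (Homeomorph.measurableEmbedding _)]
      refine integral_congr_ae (Filter.Eventually.of_forall fun x => ?_)
      have hx : 0 < ‖x.1‖ := norm_pos_iff.2 x.2
      have := hF ‖x.1‖⁻¹ (inv_pos.2 hx) x.1 x.2
      simp only [homeomorphUnitSphereProd_apply_fst_coe, homeomorphUnitSphereProd_apply_snd_coe,
        this]
      rw [inv_pow]
      field_simp
    _ = _ := integral_prod_mul (fun z : sphere (0 : E) 1 => F z) (fun r : Ioi (0 : ℝ) => r.1 ^ a * f r)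

/-- The integral over the unit sphere of the divergence of a tangential vector field vanishes, if
this divergence is homogeneous. -/
theorem sphere_integral_divergence_eq_zero {n : ℕ} [NeZero n]
    {V : Fin n → EuclideanSpace ℝ (Fin n) → ℝ} {a : ℕ} (hV : ∀ i, ContDiffOn ℝ 1 (V i) {0}ᶜ)
    (hort : ∀ x ≠ 0, ∑ i, x i * V i x = 0)
    (hhom : ∀ t : ℝ, 0 < t → ∀ x ≠ 0, ∑ i, partialDeriv i (V i) (t • x)
      = t ^ a * ∑ i, partialDeriv i (V i) x) :
    ∫ z : sphere (0 : EuclideanSpace ℝ (Fin n)) 1, ∑ i, partialDeriv i (V i) z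
      ∂(volume : Measure (EuclideanSpace ℝ (Fin n))).toSphere = 0 := by
  let b : ContDiffBump (2 : ℝ) := ⟨1 / 2, 1, by norm_num, by norm_num⟩
  let Φ : EuclideanSpace ℝ (Fin n) → ℝ := fun x => b (‖x‖ ^ 2)
  have hΦ : ContDiff ℝ 1 Φ := b.contDiff.comp (contDiff_norm_sq ℝ)
  have hts : tsupport Φ ⊆ {x | 1 ≤ ‖x‖ ^ 2 ∧ ‖x‖ ^ 2 ≤ 3} := by
    have hn : Continuous fun x : EuclideanSpace ℝ (Fin n) => ‖x‖ ^ 2 := by fun_prop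
    refine closure_minimal (fun x hx => ?_)
      ((isClosed_le continuous_const hn).inter (isClosed_le hn continuous_const))
    have h : ‖x‖ ^ 2 ∈ Function.support b := hx
    rw [b.support_eq, mem_ball, Real.dist_eq, abs_lt] at h
    have h1 : b.rOut = 1 := rfl
    constructor <;> linarith [h.1, h.2]
  have hc : HasCompactSupport Φ :=
    HasCompactSupport.of_support_subset_isCompact (isCompact_closedBall 0 2) fun x hx => by
      have := (hts (subset_tsupport _ hx)).2
      rw [mem_closedBall_zero_iff]
      nlinarith [norm_nonneg x]
  have hsupp : tsupport Φ ⊆ {0}ᶜ := by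
    rintro x hx rfl
    have := (hts hx).1
    norm_num at this
  have hgrad : ∀ x i, partialDeriv i Φ x = 2 * deriv b (‖x‖ ^ 2) * x i := fun x i => by
    have h1 : HasFDerivAt (fun y : EuclideanSpace ℝ (Fin n) => ‖y‖ ^ 2) _ x :=
      (hasStrictFDerivAt_norm_sq x).hasFDerivAt
    have h2 := (b.contDiff.differentiable (n := 1) one_ne_zero (‖x‖ ^ 2)).hasDerivAt
    have h3 := h2.comp_hasFDerivAt x h1
    rw [partialDeriv, show Φ = b ∘ fun y => ‖y‖ ^ 2 from rfl, h3.fderiv]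
    simp [EuclideanSpace.inner_single_right]
    ring
  have h0 := integral_mul_divergence_eq_zero isOpen_compl_singleton hΦ hc hsupp hV fun x hx => by
    simp only [hgrad, mul_assoc, ← Finset.mul_sum]
    rw [hort x hx]; simp
  have hpolar := integral_norm_mul_homogeneous (volume : Measure (EuclideanSpace ℝ (Fin n)))
    (fun r => b (r ^ 2)) (F := fun x => ∑ i, partialDeriv i (V i) x) hhom
  have hpolar' := integral_norm_mul_homogeneous (volume : Measure (EuclideanSpace ℝ (Fin n)))
    (fun r => b (r ^ 2)) (F := fun x => ‖x‖ ^ a) (a := a) fun t ht x _ => by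
      rw [norm_smul, Real.norm_of_nonneg ht.le, mul_pow]
  rw [h0] at hpolar
  refine (mul_eq_zero.1 hpolar.symm).resolve_right fun hr => ?_
  rw [hr, mul_zero] at hpolar'
  let x₀ : EuclideanSpace ℝ (Fin n) := EuclideanSpace.single 0 (√2)
  have hx₀ : ‖x₀‖ ^ 2 = 2 := by simp [x₀]
  have hpos : 0 < ∫ x, Φ x * ‖x‖ ^ a :=
    (hΦ.continuous.mul (by fun_prop)).integral_pos_of_hasCompactSupport_nonneg_nonzero
      (x := x₀) hc.mul_right (fun x => mul_nonneg b.nonneg (by positivity)) <| by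
        have h1 : Φ x₀ = 1 := by
          simp only [Φ, hx₀]
          exact b.one_of_mem_closedBall (by simp [b.rIn_pos.le])
        have h2 : ‖x₀‖ ≠ 0 := fun h => by rw [h] at hx₀; norm_num at hx₀
        rw [h1, one_mul]
        exact pow_ne_zero _ h2
  exact hpos.ne' hpolar'

theorem integrable_sphere_of_continuousOn {n : ℕ} {F : EuclideanSpace ℝ (Fin n) → ℝ}
    (hF : ContinuousOn F {0}ᶜ) :
    Integrable (fun z : sphere (0 : EuclideanSpace ℝ (Fin n)) 1 => F z)
      (volume : Measure (EuclideanSpace ℝ (Fin n))).toSphere :=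
  (hF.comp_continuous continuous_subtype_val fun z =>
    ne_zero_of_mem_unit_sphere z).integrable_of_hasCompactSupport (.of_compactSpace _)

/-- Green's identity on the unit sphere for homogeneous functions. -/
theorem sphere_green {n : ℕ} [NeZero n] {m d : ℕ} {u v : EuclideanSpace ℝ (Fin n) → ℝ}
    (hu : ContDiffOn ℝ 2 u {0}ᶜ) (hv : ContDiffOn ℝ 2 v {0}ᶜ)
    (hum : ∀ t : ℝ, 0 < t → ∀ x ≠ 0, u (t • x) = t ^ m * u x)
    (hvd : ∀ t : ℝ, 0 < t → ∀ x ≠ 0, v (t • x) = t ^ d * v x) :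
    ∫ z : sphere (0 : EuclideanSpace ℝ (Fin n)) 1,
        (u z * (hessian v z).trace - v z * (hessian u z).trace)
        ∂(volume : Measure (EuclideanSpace ℝ (Fin n))).toSphere
      = ((d : ℝ) - m) * (d + m + n - 2) *
        ∫ z : sphere (0 : EuclideanSpace ℝ (Fin n)) 1, u z * v z
        ∂(volume : Measure (EuclideanSpace ℝ (Fin n))).toSphere := by
  let V : Fin n → EuclideanSpace ℝ (Fin n) → ℝ := fun i x =>
    ‖x‖ ^ 2 * (u x * partialDeriv i v x - v x * partialDeriv i u x)
      - (d - m) * (u x * v x) * x i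
  have hat : ∀ {k : ℕ} {w : EuclideanSpace ℝ (Fin n) → ℝ}, k ≠ 0 → ContDiffOn ℝ k w {0}ᶜ →
      ∀ x ≠ 0, HasFDerivAt w (fderiv ℝ w x) x := fun hk hw x hx =>
    ((hw.contDiffAt (isOpen_compl_singleton.mem_nhds hx)).differentiableAt
      (by exact_mod_cast hk)).hasFDerivAt
  have hV : ∀ i, ContDiffOn ℝ 1 (V i) {0}ᶜ := fun i => by
    have hu1 := hu.of_le one_le_two
    have hv1 := hv.of_le one_le_two
    have hu' := contDiffOn_partialDeriv hu i
    have hv' := contDiffOn_partialDeriv hv i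
    have hn : ContDiffOn ℝ 1 (fun x : EuclideanSpace ℝ (Fin n) => ‖x‖ ^ 2) {0}ᶜ :=
      (contDiff_norm_sq ℝ).contDiffOn
    have hi : ContDiffOn ℝ 1 (fun x : EuclideanSpace ℝ (Fin n) => x i) {0}ᶜ :=
      (EuclideanSpace.proj i : EuclideanSpace ℝ (Fin n) →L[ℝ] ℝ).contDiff.contDiffOn
    exact (hn.mul ((hu1.mul hv').sub (hv1.mul hu'))).sub
      ((contDiffOn_const.mul (hu1.mul hv1)).mul hi)
  have heu : ∀ x ≠ 0, ∑ i, x i * partialDeriv i u x = m * u x := fun x hx =>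
    sum_mul_partialDeriv (hat two_ne_zero hu x hx).differentiableAt fun t ht => hum t ht x hx
  have hev : ∀ x ≠ 0, ∑ i, x i * partialDeriv i v x = d * v x := fun x hx =>
    sum_mul_partialDeriv (hat two_ne_zero hv x hx).differentiableAt fun t ht => hvd t ht x hx
  have hort : ∀ x ≠ 0, ∑ i, x i * V i x = 0 := fun x hx => by
    have : ∀ i, x i * V i x = ‖x‖ ^ 2 * u x * (x i * partialDeriv i v x)
        - ‖x‖ ^ 2 * v x * (x i * partialDeriv i u x) - (d - m) * (u x * v x) * (x i) ^ 2 :=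
      fun i => by simp only [V]; ring
    simp only [this, Finset.sum_sub_distrib, ← Finset.mul_sum, heu x hx, hev x hx]
    rw [← EuclideanSpace.real_norm_sq_eq]
    ring
  have hdiv : ∀ x ≠ 0, ∑ i, partialDeriv i (V i) x
      = ‖x‖ ^ 2 * (u x * (hessian v x).trace - v x * (hessian u x).trace)
        - (d - m) * (d + m + n - 2) * (u x * v x) := fun x hx => by
    have : ∀ i, partialDeriv i (V i) x = 2 * u x * (x i * partialDeriv i v x)
        - 2 * v x * (x i * partialDeriv i u x)
        + ‖x‖ ^ 2 * u x * partialDeriv i (partialDeriv i v) x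
        - ‖x‖ ^ 2 * v x * partialDeriv i (partialDeriv i u) x
        - ((d - m) * v x * (x i * partialDeriv i u x) + (d - m) * u x * (x i * partialDeriv i v x)
          + (d - m) * (u x * v x)) := fun i => by
      have h1 := (hasStrictFDerivAt_norm_sq x).hasFDerivAt
      have h2 := hat two_ne_zero hu x hx
      have h3 := hat two_ne_zero hv x hx
      have h4 := hat one_ne_zero (contDiffOn_partialDeriv hu i) x hx
      have h5 := hat one_ne_zero (contDiffOn_partialDeriv hv i) x hx
      have h6 := (EuclideanSpace.proj i : EuclideanSpace ℝ (Fin n) →L[ℝ] ℝ).hasFDerivAt (x := x)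
      have h7 : HasFDerivAt (V i) _ x := (h1.mul ((h2.mul h5).sub (h3.mul h4))).sub
        (((h2.mul h3).const_mul ((d : ℝ) - m)).mul h6)
      rw [partialDeriv, h7.fderiv]
      simp [partialDeriv, EuclideanSpace.inner_single_right]
      ring
    simp only [this, Finset.sum_sub_distrib, Finset.sum_add_distrib, ← Finset.mul_sum, heu x hx,
      hev x hx, ← trace_hessian]
    simp
    ring
  have hhom : ∀ t : ℝ, 0 < t → ∀ x ≠ 0, ∑ i, partialDeriv i (V i) (t • x)
      = t ^ (d + m) * ∑ i, partialDeriv i (V i) x := fun t ht x hx => by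
    rw [hdiv x hx, hdiv _ (smul_ne_zero ht.ne' hx), hum t ht x hx, hvd t ht x hx, norm_smul,
      Real.norm_of_nonneg ht.le]
    have h1 := trace_hessian_smul ht (hum t ht) hx
    have h2 := trace_hessian_smul ht (hvd t ht) hx
    linear_combination ‖x‖ ^ 2 * t ^ m * u x * h2 - ‖x‖ ^ 2 * t ^ d * v x * h1
  have hlap : ∀ {w : EuclideanSpace ℝ (Fin n) → ℝ}, ContDiffOn ℝ 2 w {0}ᶜ →
      ContinuousOn (fun x => (hessian w x).trace) {0}ᶜ := fun hw => by
    simp only [trace_hessian]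
    exact continuousOn_finsetSum _ fun i _ =>
      ((contDiffOn_partialDeriv hw i).continuousOn_fderiv_of_isOpen isOpen_compl_singleton
        le_rfl).clm_apply continuousOn_const
  have h0 := sphere_integral_divergence_eq_zero hV hort hhom
  rw [integral_congr_ae (g := fun z : sphere (0 : EuclideanSpace ℝ (Fin n)) 1 =>
      (u z * (hessian v z).trace - v z * (hessian u z).trace)
        - (d - m) * (d + m + n - 2) * (u z * v z)) (Filter.Eventually.of_forall fun z => by
      simp [hdiv z (ne_zero_of_mem_unit_sphere z)]), integral_sub, integral_const_mul] at h0
  · exact sub_eq_zero.1 h0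
  · exact integrable_sphere_of_continuousOn
      ((hu.continuousOn.mul (hlap hv)).sub (hv.continuousOn.mul (hlap hu)))
  · exact integrable_sphere_of_continuousOn
      (continuousOn_const.mul (hu.continuousOn.mul hv.continuousOn))

theorem partialDeriv_sub {n : ℕ} {u v : EuclideanSpace ℝ (Fin n) → ℝ}
    {x : EuclideanSpace ℝ (Fin n)} (hu : DifferentiableAt ℝ u x) (hv : DifferentiableAt ℝ v x)
    (i : Fin n) :
    partialDeriv i (fun y => u y - v y) x = partialDeriv i u x - partialDeriv i v x := by
  simp [partialDeriv, fderiv_fun_sub hu hv]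

theorem trace_hessian_sub {n : ℕ} {u v : EuclideanSpace ℝ (Fin n) → ℝ}
    (hu : ContDiffOn ℝ 2 u {0}ᶜ) (hv : ContDiffOn ℝ 2 v {0}ᶜ)
    {x : EuclideanSpace ℝ (Fin n)} (hx : x ≠ 0) :
    (hessian (fun y => u y - v y) x).trace = (hessian u x).trace - (hessian v x).trace := by
  have hd : ∀ {k : ℕ} {w : EuclideanSpace ℝ (Fin n) → ℝ}, k ≠ 0 → ContDiffOn ℝ k w {0}ᶜ →
      ∀ x ≠ 0, DifferentiableAt ℝ w x := fun hk hw x hx =>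
    (hw.contDiffAt (isOpen_compl_singleton.mem_nhds hx)).differentiableAt (by exact_mod_cast hk)
  simp only [trace_hessian, ← Finset.sum_sub_distrib]
  refine Finset.sum_congr rfl fun i _ => ?_
  have h : partialDeriv i (fun y => u y - v y)
      =ᶠ[nhds x] fun y => partialDeriv i u y - partialDeriv i v y := by
    filter_upwards [isOpen_compl_singleton.mem_nhds hx] with y hy
    exact partialDeriv_sub (hd two_ne_zero hu y hy) (hd two_ne_zero hv y hy) i
  rw [partialDeriv, h.fderiv_eq, ← partialDeriv, partialDeriv_sub
    (hd one_ne_zero (contDiffOn_partialDeriv hu i) x hx)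
    (hd one_ne_zero (contDiffOn_partialDeriv hv i) x hx)]

open MvPolynomial in
theorem MvPolynomial.IsHomogeneous.eval_smul_apply {σ R : Type*} [CommSemiring R] [Fintype σ]
    {p : MvPolynomial σ R} {m : ℕ} (hp : p.IsHomogeneous m) (t : R) (x : σ → R) :
    eval (fun i => t * x i) p = t ^ m * eval x p := by
  rw [eval_eq', eval_eq', Finset.mul_sum]
  refine Finset.sum_congr rfl fun d hd => ?_
  have : ∑ i, d i = m := by
    rw [← hp (mem_support_iff.1 hd), ← Finsupp.degree_eq_sum, Finsupp.degree_eq_weight_one]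
    rfl
  simp only [mul_pow, Finset.prod_mul_distrib, Finset.prod_pow_eq_pow_sum, this]
  ring

theorem partialDeriv_eval {n : ℕ} (p : MvPolynomial (Fin n) ℝ) (i : Fin n) :
    partialDeriv i (fun x => MvPolynomial.eval (fun j => x j) p)
      = fun x => MvPolynomial.eval (fun j => x j) (MvPolynomial.pderiv i p) := by
  funext x
  suffices h : ∃ L : EuclideanSpace ℝ (Fin n) →L[ℝ] ℝ,
      HasFDerivAt (fun x : EuclideanSpace ℝ (Fin n) => MvPolynomial.eval (fun j => x j) p) L x ∧
      L (EuclideanSpace.single i 1)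
        = MvPolynomial.eval (fun j => x j) (MvPolynomial.pderiv i p) by
    obtain ⟨L, hL, h⟩ := h
    rw [partialDeriv, hL.fderiv, h]
  induction p using MvPolynomial.induction_on with
  | C a => exact ⟨0, by simpa using hasFDerivAt_const a x, by simp⟩
  | add p q hp hq =>
    obtain ⟨L, hL, h⟩ := hp
    obtain ⟨M, hM, h'⟩ := hq
    exact ⟨L + M, by simp only [map_add]; exact hL.add hM, by simp [h, h']⟩
  | mul_X p j hp =>
    obtain ⟨L, hL, h⟩ := hp
    have hM := (EuclideanSpace.proj j : EuclideanSpace ℝ (Fin n) →L[ℝ] ℝ).hasFDerivAt (x := x)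
    refine ⟨_, by simp only [map_mul, MvPolynomial.eval_X]; exact hL.mul hM, ?_⟩
    rcases eq_or_ne j i with rfl | hji
    · simp [h]
    · simp [h, MvPolynomial.pderiv_X_of_ne hji, hji.symm]

theorem contDiff_eval {n : ℕ} (p : MvPolynomial (Fin n) ℝ) {k : WithTop ℕ∞} :
    ContDiff ℝ k (fun x : EuclideanSpace ℝ (Fin n) => MvPolynomial.eval (fun j => x j) p) := by
  induction p using MvPolynomial.induction_on with
  | C a => simpa using contDiff_const
  | add p q hp hq => simpa using hp.add hq
  | mul_X p j hp =>
    simpa using hp.mul (EuclideanSpace.proj j : EuclideanSpace ℝ (Fin n) →L[ℝ] ℝ).contDiff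

/-- The Laplacian of a polynomial. -/
noncomputable def polyLaplacian {n : ℕ} (p : MvPolynomial (Fin n) ℝ) : MvPolynomial (Fin n) ℝ :=
  ∑ i, MvPolynomial.pderiv i (MvPolynomial.pderiv i p)

theorem trace_hessian_eval {n : ℕ} (p : MvPolynomial (Fin n) ℝ)
    (x : EuclideanSpace ℝ (Fin n)) :
    (hessian (fun y => MvPolynomial.eval (fun i => y i) p) x).trace
      = MvPolynomial.eval (fun i => x i) (polyLaplacian p) := by
  simp [trace_hessian, partialDeriv_eval, polyLaplacian]

theorem polyLaplacian_isHomogeneous {n d : ℕ} {p : MvPolynomial (Fin n) ℝ}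
    (hp : p.IsHomogeneous d) : (polyLaplacian p).IsHomogeneous (d - 2) :=
  MvPolynomial.IsHomogeneous.sum _ _ _ fun _ _ => hp.pderiv.pderiv

theorem polyLaplacian_eq_zero {n d : ℕ} {p : MvPolynomial (Fin n) ℝ}
    (hp : p.IsHomogeneous d) (hd : d < 2) : polyLaplacian p = 0 := by
  refine Finset.sum_eq_zero fun i _ => ?_
  have h : (MvPolynomial.pderiv i p).IsHomogeneous 0 := by
    simpa [Nat.sub_eq_zero_of_le (Nat.le_of_lt_succ hd)] using hp.pderiv (i := i)
  rw [MvPolynomial.totalDegree_eq_zero_iff_eq_C.1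
    ((MvPolynomial.totalDegree_zero_iff_isHomogeneous _).2 h), MvPolynomial.pderiv_C]

/-- Restriction of functions on `ℝⁿ \ {0}` to the unit sphere. -/
noncomputable def sphereRestrict {n : ℕ} (u : EuclideanSpace ℝ (Fin n) → ℝ)
    (hu : ContinuousOn u {0}ᶜ) : C(sphere (0 : EuclideanSpace ℝ (Fin n)) 1, ℝ) :=
  ⟨fun z => u z, hu.comp_continuous continuous_subtype_val fun z => ne_zero_of_mem_unit_sphere z⟩

/-- Restriction of polynomials to the unit sphere. -/
noncomputable def sphereEval (n : ℕ) :
    MvPolynomial (Fin n) ℝ →ₐ[ℝ] C(sphere (0 : EuclideanSpace ℝ (Fin n)) 1, ℝ) :=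
  MvPolynomial.aeval fun i => ⟨fun z => z.1 i, by fun_prop⟩

theorem sphereEval_apply {n : ℕ} (p : MvPolynomial (Fin n) ℝ)
    (z : sphere (0 : EuclideanSpace ℝ (Fin n)) 1) :
    sphereEval n p z = MvPolynomial.eval (fun i => z.1 i) p := by
  induction p using MvPolynomial.induction_on with
  | C a => simp [sphereEval]
  | add p q hp hq => simp [hp, hq]
  | mul_X p j hp => rw [map_mul, ContinuousMap.mul_apply, hp]; simp [sphereEval]

/-- The inclusion of the continuous functions on the unit sphere into the square-integrable ones. -/
noncomputable def sphereL2 (n : ℕ) : C(sphere (0 : EuclideanSpace ℝ (Fin n)) 1, ℝ) →L[ℝ]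
    Lp ℝ 2 (volume : Measure (EuclideanSpace ℝ (Fin n))).toSphere :=
  ContinuousMap.toLp 2 _ ℝ

theorem inner_sphereL2 {n : ℕ} (f g : C(sphere (0 : EuclideanSpace ℝ (Fin n)) 1, ℝ)) :
    inner ℝ (sphereL2 n f) (sphereL2 n g)
      = ∫ z, f z * g z ∂(volume : Measure (EuclideanSpace ℝ (Fin n))).toSphere := by
  rw [sphereL2, ContinuousMap.inner_toLp]
  simp [mul_comm]

theorem sphereL2_injective (n : ℕ) : Function.Injective (sphereL2 n) :=
  ContinuousMap.toLp_injective _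

/-- The polynomials are dense in the continuous functions on the sphere. -/
theorem eq_zero_of_inner_sphereEval_eq_zero {n : ℕ}
    (f : C(sphere (0 : EuclideanSpace ℝ (Fin n)) 1, ℝ))
    (hf : ∀ d, ∀ q : MvPolynomial (Fin n) ℝ, q.IsHomogeneous d →
      inner ℝ (sphereL2 n f) (sphereL2 n (sphereEval n q)) = 0) : f = 0 := by
  have hq : ∀ q, inner ℝ (sphereL2 n f) (sphereL2 n (sphereEval n q)) = 0 := fun q => by
    rw [← MvPolynomial.sum_homogeneousComponent q, map_sum, map_sum, inner_sum]
    exact Finset.sum_eq_zero fun d _ =>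
      hf d _ (MvPolynomial.homogeneousComponent_isHomogeneous d q)
  have hsep : (sphereEval n).range.SeparatesPoints := fun x y hxy => by
    obtain ⟨i, hi⟩ : ∃ i, x.1 i ≠ y.1 i := by
      by_contra! h
      exact hxy (Subtype.ext (by ext i; exact h i))
    exact ⟨_, ⟨sphereEval n (MvPolynomial.X i), ⟨_, rfl⟩, rfl⟩, by simpa [sphereEval_apply] using hi⟩
  have hmem : f ∈ (sphereEval n).range.topologicalClosure := by
    rw [ContinuousMap.subalgebra_topologicalClosure_eq_top_of_separatesPoints _ hsep]
    trivial
  have hcl : IsClosed {g | inner ℝ (sphereL2 n f) (sphereL2 n g) = 0} :=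
    isClosed_eq (continuous_const.inner (sphereL2 n).continuous) continuous_const
  have : inner ℝ (sphereL2 n f) (sphereL2 n f) = 0 :=
    closure_minimal (by rintro _ ⟨q, rfl⟩; exact hq q) hcl hmem
  rw [inner_self_eq_zero] at this
  exact sphereL2_injective n (by simpa using this)

theorem eq_zero_of_sphereEval_eq_zero {n d : ℕ} [NeZero n] {p : MvPolynomial (Fin n) ℝ}
    (hp : p.IsHomogeneous d) (h : sphereEval n p = 0) : p = 0 := by
  refine MvPolynomial.funext fun x => ?_
  obtain ⟨t, z, hz⟩ : ∃ (t : ℝ) (z : sphere (0 : EuclideanSpace ℝ (Fin n)) 1),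
      ∀ i, x i = t * z.1 i := by
    rcases eq_or_ne (WithLp.toLp 2 x) 0 with hx | hx
    · refine ⟨0, ⟨EuclideanSpace.single 0 1, by simp⟩, fun i => ?_⟩
      simpa using congrArg (fun y : EuclideanSpace ℝ (Fin n) => y i) hx
    · have hx' := norm_ne_zero_iff.2 hx
      refine ⟨‖WithLp.toLp 2 x‖, ⟨‖WithLp.toLp 2 x‖⁻¹ • WithLp.toLp 2 x, ?_⟩, fun i => ?_⟩
      · simp [norm_smul, hx']
      · simp [hx']
  rw [show x = fun i => t * z.1 i from funext hz, hp.eval_smul_apply, ← sphereEval_apply, h]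
  simp

theorem exists_isHomogeneous_inner_eq {n : ℕ} (m : ℕ)
    (f : Lp ℝ 2 (volume : Measure (EuclideanSpace ℝ (Fin n))).toSphere) :
    ∃ p : MvPolynomial (Fin n) ℝ, p.IsHomogeneous m ∧
      ∀ q : MvPolynomial (Fin n) ℝ, q.IsHomogeneous m →
        inner ℝ (f - sphereL2 n (sphereEval n p)) (sphereL2 n (sphereEval n q)) = 0 := by
  have := Module.Finite.iff_fg.2 (MvPolynomial.homogeneousSubmodule_fg (Fin n) ℝ m)
  let K := (MvPolynomial.homogeneousSubmodule (Fin n) ℝ m).map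
    ((sphereL2 n).toLinearMap ∘ₗ (sphereEval n).toLinearMap)
  obtain ⟨p, hp, hpK⟩ := K.starProjection_apply_mem f
  refine ⟨p, hp, fun q hq => ?_⟩
  have h := K.starProjection_inner_eq_zero f (sphereL2 n (sphereEval n q)) ⟨q, hq, rfl⟩
  rwa [← hpK] at h

section

variable {n m : ℕ} [NeZero n] {u : EuclideanSpace ℝ (Fin n) → ℝ}

theorem inner_polyLaplacian (hu : ContDiffOn ℝ 2 u {0}ᶜ)
    (hum : ∀ t : ℝ, 0 < t → ∀ x ≠ 0, u (t • x) = t ^ m * u x)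
    (hharm : ∀ x ≠ 0, (hessian u x).trace = 0) {d : ℕ} {q : MvPolynomial (Fin n) ℝ}
    (hq : q.IsHomogeneous d) :
    inner ℝ (sphereL2 n (sphereRestrict u hu.continuousOn))
        (sphereL2 n (sphereEval n (polyLaplacian q)))
      = ((d : ℝ) - m) * (d + m + n - 2) *
        inner ℝ (sphereL2 n (sphereRestrict u hu.continuousOn)) (sphereL2 n (sphereEval n q)) := by
  have h := sphere_green hu (contDiff_eval q).contDiffOn hum (d := d)
    fun t _ x _ => by simpa using hq.eval_smul_apply t x
  simp only [inner_sphereL2, sphereEval_apply]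
  rw [← integral_congr_ae (Filter.Eventually.of_forall fun z => ?_)] at h
  · exact h
  · simp [hharm z (ne_zero_of_mem_unit_sphere z), trace_hessian_eval, sphereRestrict]

theorem inner_polyLaplacian_comm {p q : MvPolynomial (Fin n) ℝ} (hp : p.IsHomogeneous m)
    (hq : q.IsHomogeneous m) :
    inner ℝ (sphereL2 n (sphereEval n p)) (sphereL2 n (sphereEval n (polyLaplacian q)))
      = inner ℝ (sphereL2 n (sphereEval n (polyLaplacian p))) (sphereL2 n (sphereEval n q)) := by
  have h := sphere_green (contDiff_eval p).contDiffOn (contDiff_eval q).contDiffOn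
    (fun t _ x _ => by simpa using hp.eval_smul_apply t x)
    (fun t _ x _ => by simpa using hq.eval_smul_apply t x)
  rw [sub_self, zero_mul, zero_mul] at h
  rw [← sub_eq_zero, ← h, real_inner_comm (sphereL2 n (sphereEval n q)), inner_sphereL2,
    inner_sphereL2, ← integral_sub]
  · simp [sphereEval_apply, trace_hessian_eval]
  all_goals
    exact Continuous.integrable_of_hasCompactSupport (by fun_prop) (.of_compactSpace _)

/-- A homogeneous harmonic function of degree `m` that is orthogonal to the homogeneous
polynomials of lower degree than `d` is orthogonal to those of degree `d`, if `d ≠ m`. -/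
theorem inner_eq_zero_of_forall_lt (hn : 2 ≤ n) (hu : ContDiffOn ℝ 2 u {0}ᶜ)
    (hum : ∀ t : ℝ, 0 < t → ∀ x ≠ 0, u (t • x) = t ^ m * u x)
    (hharm : ∀ x ≠ 0, (hessian u x).trace = 0) {d : ℕ} (hd : d ≠ m)
    (hlt : ∀ e < d, ∀ q : MvPolynomial (Fin n) ℝ, q.IsHomogeneous e →
      inner ℝ (sphereL2 n (sphereRestrict u hu.continuousOn)) (sphereL2 n (sphereEval n q)) = 0)
    {q : MvPolynomial (Fin n) ℝ} (hq : q.IsHomogeneous d) :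
    inner ℝ (sphereL2 n (sphereRestrict u hu.continuousOn)) (sphereL2 n (sphereEval n q)) = 0 := by
  have h := inner_polyLaplacian hu hum hharm hq
  have h0 : inner ℝ (sphereL2 n (sphereRestrict u hu.continuousOn))
      (sphereL2 n (sphereEval n (polyLaplacian q))) = 0 := by
    rcases lt_or_ge d 2 with h2 | h2
    · simp [polyLaplacian_eq_zero hq h2]
    · exact hlt (d - 2) (by omega) _ (polyLaplacian_isHomogeneous hq)
  rw [h0] at h
  refine (mul_eq_zero.1 h.symm).resolve_left (mul_ne_zero ?_ ?_)
  · exact sub_ne_zero.2 (by exact_mod_cast hd)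
  · have h1 : (2 : ℝ) ≤ n := by exact_mod_cast hn
    have h2 : (1 : ℝ) ≤ d + m := by exact_mod_cast (by omega : 1 ≤ d + m)
    linarith

theorem inner_eq_zero_of_lt (hn : 2 ≤ n) (hu : ContDiffOn ℝ 2 u {0}ᶜ)
    (hum : ∀ t : ℝ, 0 < t → ∀ x ≠ 0, u (t • x) = t ^ m * u x)
    (hharm : ∀ x ≠ 0, (hessian u x).trace = 0) (d : ℕ) (hd : d < m)
    (q : MvPolynomial (Fin n) ℝ) (hq : q.IsHomogeneous d) :
    inner ℝ (sphereL2 n (sphereRestrict u hu.continuousOn)) (sphereL2 n (sphereEval n q)) = 0 := by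
  induction d using Nat.strong_induction_on generalizing q with
  | _ d ih =>
    exact inner_eq_zero_of_forall_lt hn hu hum hharm hd.ne
      (fun e he q hq => ih e he (he.trans hd) q hq) hq

/-- A homogeneous harmonic function of degree `m` that is orthogonal to the homogeneous
polynomials of degree `m` vanishes. -/
theorem eq_zero_of_inner_eq_zero (hn : 2 ≤ n) (hu : ContDiffOn ℝ 2 u {0}ᶜ)
    (hum : ∀ t : ℝ, 0 < t → ∀ x ≠ 0, u (t • x) = t ^ m * u x)
    (hharm : ∀ x ≠ 0, (hessian u x).trace = 0)
    (horth : ∀ q : MvPolynomial (Fin n) ℝ, q.IsHomogeneous m →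
      inner ℝ (sphereL2 n (sphereRestrict u hu.continuousOn)) (sphereL2 n (sphereEval n q)) = 0)
    {x : EuclideanSpace ℝ (Fin n)} (hx : x ≠ 0) : u x = 0 := by
  have h := eq_zero_of_inner_sphereEval_eq_zero (sphereRestrict u hu.continuousOn) fun d => by
    induction d using Nat.strong_induction_on with
    | _ d ih =>
      rcases eq_or_ne d m with rfl | hd
      · exact horth
      · exact fun q hq => inner_eq_zero_of_forall_lt hn hu hum hharm hd ih hq
  have hx' := norm_pos_iff.2 hx
  have h1 : u (‖x‖⁻¹ • x) = 0 :=
    congrArg (fun f => f ⟨‖x‖⁻¹ • x, by simp [norm_smul, hx'.ne']⟩) h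
  rw [hum _ (inv_pos.2 hx') x hx] at h1
  exact (mul_eq_zero.1 h1).resolve_left (pow_ne_zero _ (inv_pos.2 hx').ne')

/-- The orthogonal projection of a homogeneous harmonic function of degree `m` to the homogeneous
polynomials of degree `m` is harmonic. -/
theorem polyLaplacian_eq_zero_of_inner_eq (hn : 2 ≤ n) (hu : ContDiffOn ℝ 2 u {0}ᶜ)
    (hum : ∀ t : ℝ, 0 < t → ∀ x ≠ 0, u (t • x) = t ^ m * u x)
    (hharm : ∀ x ≠ 0, (hessian u x).trace = 0) {p : MvPolynomial (Fin n) ℝ}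
    (hp : p.IsHomogeneous m)
    (horth : ∀ q : MvPolynomial (Fin n) ℝ, q.IsHomogeneous m →
      inner ℝ (sphereL2 n (sphereRestrict u hu.continuousOn) - sphereL2 n (sphereEval n p))
        (sphereL2 n (sphereEval n q)) = 0) : polyLaplacian p = 0 := by
  rcases lt_or_ge m 2 with hm | hm
  · exact polyLaplacian_eq_zero hp hm
  let s : MvPolynomial (Fin n) ℝ := ∑ i, MvPolynomial.X i ^ 2
  have hs : s.IsHomogeneous 2 := MvPolynomial.IsHomogeneous.sum _ _ _ fun i _ =>
    MvPolynomial.isHomogeneous_X_pow i 2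
  have hs1 : sphereEval n s = 1 := by
    ext z
    have hz : ‖z.1‖ = 1 := mem_sphere_zero_iff_norm.1 z.2
    rw [sphereEval_apply]
    simp [s, ← EuclideanSpace.real_norm_sq_eq, hz]
  have hmul : ∀ q, q.IsHomogeneous (m - 2) → (s * q).IsHomogeneous m := fun q hq => by
    simpa [Nat.add_sub_of_le hm] using hs.mul hq
  have hev : ∀ q, sphereEval n (s * q) = sphereEval n q := fun q => by
    rw [map_mul, hs1, one_mul]
  have hL := polyLaplacian_isHomogeneous hp
  have hL' := polyLaplacian_isHomogeneous (hmul _ hL)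
  have h1 := inner_polyLaplacian_comm hp (hmul _ hL)
  have h2 := horth _ (hmul _ hL')
  rw [inner_sub_left, hev, inner_eq_zero_of_lt hn hu hum hharm _ (by omega) _ hL', zero_sub,
    neg_eq_zero] at h2
  rw [h2, hev] at h1
  refine eq_zero_of_sphereEval_eq_zero hL (sphereL2_injective n ?_)
  rw [map_zero]
  exact inner_self_eq_zero.1 h1.symm

end

theorem stmt9 {n : ℕ} (hn : 2 ≤ n) (m : ℕ)
    (u : EuclideanSpace ℝ (Fin n) → ℝ)
    (hu : ContDiffOn ℝ 2 u {(0 : EuclideanSpace ℝ (Fin n))}ᶜ)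
    (hhom : ∀ t : ℝ, 0 < t → ∀ x : EuclideanSpace ℝ (Fin n), x ≠ 0 →
      u (t • x) = t ^ (m : ℝ) * u x)
    (hharm : ∀ x : EuclideanSpace ℝ (Fin n), x ≠ 0 → (hessian u x).trace = 0) :
    ∃ p : MvPolynomial (Fin n) ℝ, p.IsHomogeneous m ∧
      (∀ x : EuclideanSpace ℝ (Fin n),
        (hessian (fun y => MvPolynomial.eval (fun i => y i) p) x).trace = 0) ∧
      (∀ x : EuclideanSpace ℝ (Fin n), x ≠ 0 →
        u x = MvPolynomial.eval (fun i => x i) p) := by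
  have : NeZero n := ⟨by omega⟩
  simp only [Real.rpow_natCast] at hhom
  obtain ⟨p, hp, horth⟩ :=
    exists_isHomogeneous_inner_eq m (sphereL2 n (sphereRestrict u hu.continuousOn))
  have hlap := polyLaplacian_eq_zero_of_inner_eq hn hu hhom hharm hp horth
  have hpharm : ∀ x : EuclideanSpace ℝ (Fin n),
      (hessian (fun y => MvPolynomial.eval (fun i => y i) p) x).trace = 0 := fun x => by
    rw [trace_hessian_eval, hlap, map_zero]
  refine ⟨p, hp, hpharm, fun x hx => sub_eq_zero.1 ?_⟩
  have hpC : ContDiffOn ℝ 2 (fun x : EuclideanSpace ℝ (Fin n) =>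
    MvPolynomial.eval (fun i => x i) p) {0}ᶜ := (contDiff_eval p).contDiffOn
  have hf := hu.sub hpC
  refine eq_zero_of_inner_eq_zero (m := m)
    (u := fun x => u x - MvPolynomial.eval (fun i => x i) p) hn hf
    (fun t ht x hx => ?_) (fun x hx => ?_) (fun q hq => ?_) hx
  · have := hp.eval_smul_apply t x
    simp only [PiLp.smul_apply, smul_eq_mul, this, hhom t ht x hx]
    ring
  · rw [trace_hessian_sub hu hpC hx, hharm x hx, hpharm x, sub_zero]
  · rw [← horth q hq, ← map_sub]
    congr 2
    ext z
    simp [sphereRestrict, sphereEval_apply]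
end
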